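/- (Eigenmatrix Theorem, column form) Let A be an n×n diagonalizable matrix over ℂ and let λ₁, …, λ_p be pairwise distinct scalars such that every eigenvalue of A is among λ₁, …, λ_p. Then for each index i, every nonzero column of the product of the complementary eigenmatrices ∏_{j ≠ i} (A − λ_jI) is an eigenvector of A for the eigenvalue λ_i. -/

import Mathlib

open Matrix in
theorem Matrix.prod_map_conj_diagonal_sub_smul_one {ι n K : Type*} [Fintype n] [DecidableEq n]
    [Field K] (P : Matrix n n K) (hP : IsUnit P.det) (d : n → K) (c : ι → K) (l : List ι) :
    (l.map (fun j => P * diagonal d * P⁻¹ - c j • (1 : Matrix n n K))).prod =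
      P * diagonal (fun k => (l.map (fun j => d k - c j)).prod) * P⁻¹ := by
  induction l with
  | nil => simp [Matrix.mul_nonsing_inv P hP]
  | cons a l ih =>
    have factor : P * diagonal d * P⁻¹ - c a • (1 : Matrix n n K) =
        P * diagonal (fun k => d k - c a) * P⁻¹ := by
      have h : diagonal (fun k => d k - c a) = diagonal d - c a • (1 : Matrix n n K) := by
        rw [Matrix.smul_one_eq_diagonal, Matrix.diagonal_sub]
      rw [h, Matrix.mul_sub, Matrix.sub_mul, Matrix.mul_smul, Matrix.mul_one, Matrix.smul_mul,
        Matrix.mul_nonsing_inv P hP]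
    rw [List.map_cons, List.prod_cons, ih, factor]
    simp only [Matrix.mul_assoc, Matrix.nonsing_inv_mul_cancel_left P _ hP, List.map_cons,
      List.prod_cons]
    rw [← Matrix.mul_assoc (diagonal _) (diagonal _), Matrix.diagonal_mul_diagonal]

open Matrix in
theorem Matrix.exists_mulVec_eq_smul_of_conj_diagonal {n K : Type*} [Fintype n] [DecidableEq n]
    [Field K] (P : Matrix n n K) (hP : IsUnit P.det) (d : n → K) (k : n) :
    ∃ v : n → K, v ≠ 0 ∧ (P * diagonal d * P⁻¹) *ᵥ v = d k • v := by
  refine ⟨P *ᵥ Pi.single k 1, fun h => ?_, ?_⟩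
  · have h' := congrArg (P⁻¹ *ᵥ ·) h
    simp only [Matrix.mulVec_mulVec, Matrix.nonsing_inv_mul P hP, Matrix.one_mulVec,
      Matrix.mulVec_zero] at h'
    simpa using congrFun h' k
  · rw [Matrix.mulVec_mulVec, Matrix.nonsing_inv_mul_cancel_right P _ hP, ← Matrix.mulVec_mulVec,
      Matrix.diagonal_mulVec_single, ← Matrix.mulVec_smul, ← Pi.single_smul, smul_eq_mul]


/-- Eigenmatrix Theorem (column form): let `A` be an `n × n` diagonalizable
complex matrix and `lam : Fin p → ℂ` pairwise distinct scalars such that every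
eigenvalue of `A` is among them. Then for each `i`, every nonzero column of the
product of the complementary eigenmatrices `∏_{j ≠ i} (A - lam j • I)` is an
eigenvector of `A` for the eigenvalue `lam i`. -/
theorem eigenmatrix_theorem_columns {n p : ℕ} (A : Matrix (Fin n) (Fin n) ℂ)
    (lam : Fin p → ℂ) (hinj : Function.Injective lam)
    (hdiag : ∃ P D : Matrix (Fin n) (Fin n) ℂ, IsUnit P.det ∧ D.IsDiag ∧ A = P * D * P⁻¹)
    (hspec : ∀ μ : ℂ, (∃ v : Fin n → ℂ, v ≠ 0 ∧ A.mulVec v = μ • v) →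
      ∃ i : Fin p, μ = lam i) :
    ∀ i : Fin p,
      let M := (((List.finRange p).filter (fun j => j ≠ i)).map
        (fun j => A - lam j • (1 : Matrix (Fin n) (Fin n) ℂ))).prod
      ∀ k : Fin n, (fun r => M r k) ≠ 0 →
        A.mulVec (fun r => M r k) = lam i • (fun r => M r k) := by
  intro i M k _
  obtain ⟨P, D, hP, hD, rfl⟩ := hdiag
  obtain ⟨d, rfl⟩ : ∃ d, D = Matrix.diagonal d := ⟨D.diag, hD.diagonal_diag.symm⟩
  have hM : M = _ := Matrix.prod_map_conj_diagonal_sub_smul_one P hP d lam _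
  have key : P * Matrix.diagonal d * P⁻¹ * M = lam i • M := by
    rw [hM]
    simp only [Matrix.mul_assoc, Matrix.nonsing_inv_mul_cancel_left P _ hP]
    rw [← Matrix.mul_assoc (Matrix.diagonal _) (Matrix.diagonal _), Matrix.diagonal_mul_diagonal,
      ← Matrix.mul_smul, ← Matrix.smul_mul, ← Matrix.diagonal_smul]
    congr 3
    funext m
    obtain ⟨j, hj⟩ := hspec (d m) (Matrix.exists_mulVec_eq_smul_of_conj_diagonal P hP d m)
    by_cases hji : j = i
    · simp [hj, hji]
    · have h0 : (((List.finRange p).filter (fun j => j ≠ i)).map (fun j => d m - lam j)).prod = 0 :=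
        List.prod_eq_zero (List.mem_map.2 ⟨j, by simp [hji], by simp [hj]⟩)
      simp only [Pi.smul_apply, h0, mul_zero, smul_zero]
  funext r
  exact congrFun (congrFun key r) k
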